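/- For every μ ∈ (0,1) there exist a constant C ≥ 1 and a map T which, for every dimension d ≥ 1, takes as input a finite tuple S of points of ℝ^d, a unit vector v ∈ ℝ^d, and ε, δ ∈ (0,1), and outputs `Accept` or `Reject` (with the acceptance event measurable in the sample), such that for all ε, δ ∈ (0,1): (Completeness) if S consists of N ≥ (C·d/(ε·δ))^C i.i.d. samples from N(0,I_d), then with probability at least 1 − C·δ the sample S is such that T(S, v, ε, δ) = `Accept` simultaneously for every unit vector v ∈ ℝ^d; (Soundness) for every finite tuple S and unit vector v, if T(S, v, ε, δ) = `Accept`, then for every unit vector v' ∈ ℝ^d one has (1−μ)·∠(v,v')/π − C·ε ≤ Pr_{x∼S}[sign(v·x) ≠ sign(v'·x)] ≤ (1+μ)·∠(v,v')/π + C·ε. -/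

import Mathlib

open MeasureTheory ProbabilityTheory Real
open scoped ENNReal

noncomputable section

/-- `sgn t = 1` if `t ≥ 0` and `-1` otherwise. -/
def sgn (t : ℝ) : ℝ := if 0 ≤ t then 1 else -1

/-- Euclidean dot product on `ℝ^d`. -/
def dotp {d : ℕ} (v w : Fin d → ℝ) : ℝ := ∑ i, v i * w i

/-- `v` is a unit vector. -/
def IsUnitVec {d : ℕ} (v : Fin d → ℝ) : Prop := dotp v v = 1

/-- The standard Gaussian measure `N(0, I_d)` on `ℝ^d`. -/
def stdGaussian (d : ℕ) : Measure (Fin d → ℝ) := Measure.pi fun _ => gaussianReal 0 1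

/-- The angle `∠(v, v') = arccos (v ⬝ v')` between unit vectors. -/
def angleOf {d : ℕ} (v w : Fin d → ℝ) : ℝ := Real.arccos (dotp v w)

/-- Number of entries of the tuple `S` satisfying `P` (with multiplicity). -/
def cnt {N : ℕ} {α : Type*} (S : Fin N → α) (P : α → Prop) : ℕ :=
  Nat.card {i : Fin N // P (S i)}

/-- Fraction of entries of the tuple `S` satisfying `P` (with multiplicity). -/
def frac {N : ℕ} {α : Type*} (S : Fin N → α) (P : α → Prop) : ℝ :=
  (cnt S P : ℝ) / N

lemma charInt_pi {d : ℕ} (w : Fin d → ℝ) :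
    ∫ x, Complex.exp ((dotp w x : ℝ) * Complex.I) ∂(_root_.stdGaussian d)
      = Complex.exp (-(dotp w w : ℝ) / 2) := by
  unfold _root_.stdGaussian dotp
  have h : ∀ x : Fin d → ℝ, Complex.exp (((∑ i, w i * x i : ℝ) : ℂ) * Complex.I)
      = ∏ i, Complex.exp ((w i : ℂ) * (x i : ℂ) * Complex.I) := by
    intro x
    rw [← Complex.exp_sum]
    congr 1
    push_cast
    rw [Finset.sum_mul]
  simp_rw [h]
  rw [integral_fintype_prod_eq_prod (f := fun i (x : ℝ) => Complex.exp ((w i : ℂ) * (x : ℂ) * Complex.I))]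
  simp_rw [← charFun_apply_real, charFun_gaussianReal]
  rw [← Complex.exp_sum]
  congr 1
  push_cast
  rw [← Finset.sum_neg_distrib, Finset.sum_div]
  refine Finset.sum_congr rfl fun i _ => ?_
  simp
  ring

lemma charInt_prod (a b : ℝ) :
    ∫ p : ℝ × ℝ, Complex.exp (((a * p.1 + b * p.2 : ℝ) : ℂ) * Complex.I)
        ∂((gaussianReal 0 1).prod (gaussianReal 0 1))
      = Complex.exp (-((a * a + b * b : ℝ) : ℂ) / 2) := by
  have h : ∀ p : ℝ × ℝ, Complex.exp (((a * p.1 + b * p.2 : ℝ) : ℂ) * Complex.I)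
      = Complex.exp ((a : ℂ) * (p.1 : ℂ) * Complex.I) *
        Complex.exp ((b : ℂ) * (p.2 : ℂ) * Complex.I) := by
    intro x
    rw [← Complex.exp_add]
    congr 1
    push_cast
    ring
  simp_rw [h]
  rw [integral_prod_mul (f := fun x : ℝ => Complex.exp ((a : ℂ) * (x : ℂ) * Complex.I))
    (g := fun x : ℝ => Complex.exp ((b : ℂ) * (x : ℂ) * Complex.I))]
  simp_rw [← charFun_apply_real, charFun_gaussianReal]
  rw [← Complex.exp_add]
  congr 1
  push_cast
  simp
  ring

lemma measurable_dotp {d : ℕ} (v : Fin d → ℝ) : Measurable (fun x => dotp v x) := by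
  unfold dotp; fun_prop

instance {d : ℕ} : IsProbabilityMeasure (_root_.stdGaussian d) := by
  unfold _root_.stdGaussian; infer_instance

lemma dotp_comb {d : ℕ} (v w x : Fin d → ℝ) (a b : ℝ) :
    dotp (fun i => a * v i + b * w i) x = a * dotp v x + b * dotp w x := by
  unfold dotp
  rw [Finset.mul_sum, Finset.mul_sum, ← Finset.sum_add_distrib]
  exact Finset.sum_congr rfl fun i _ => by ring

lemma dotp_comm {d : ℕ} (v w : Fin d → ℝ) : dotp v w = dotp w v := by
  unfold dotp
  exact Finset.sum_congr rfl fun i _ => by ring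

lemma map_pair {d : ℕ} (v w : Fin d → ℝ) (c s : ℝ) (hv : IsUnitVec v) (hw : IsUnitVec w)
    (hc : dotp v w = c) (hcs : c ^ 2 + s ^ 2 = 1) :
    (_root_.stdGaussian d).map (fun x => (dotp v x, dotp w x)) =
    ((gaussianReal 0 1).prod (gaussianReal 0 1)).map
      (fun p : ℝ × ℝ => (p.1, c * p.1 + s * p.2)) := by
  have m1 : Measurable (fun x : Fin d → ℝ => (dotp v x, dotp w x)) :=
    (measurable_dotp v).prodMk (measurable_dotp w)
  have m2 : Measurable (fun p : ℝ × ℝ => (p.1, c * p.1 + s * p.2)) := by fun_prop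
  have := Measure.isProbabilityMeasure_map (μ := _root_.stdGaussian d) m1.aemeasurable
  have := Measure.isProbabilityMeasure_map
    (μ := (gaussianReal 0 1).prod (gaussianReal 0 1)) m2.aemeasurable
  apply Measure.ext_of_charFunDual
  ext L
  have hL : ∀ p q : ℝ, L (p, q) = L (1, 0) * p + L (0, 1) * q := by
    intro p q
    have : (p, q) = p • ((1 : ℝ), (0 : ℝ)) + q • ((0 : ℝ), (1 : ℝ)) := by simp
    rw [this, map_add, map_smul, map_smul]
    simp [mul_comm]
  generalize L (1, 0) = a at hL
  generalize L (0, 1) = b at hL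
  rw [charFunDual_apply, charFunDual_apply, integral_map m1.aemeasurable (by fun_prop),
    integral_map m2.aemeasurable (by fun_prop)]
  simp_rw [hL, ← dotp_comb]
  have e : ∀ p : ℝ × ℝ, a * p.1 + b * (c * p.1 + s * p.2) = (a + b * c) * p.1 + (b * s) * p.2 := by
    intro p; ring
  simp_rw [e]
  rw [charInt_pi, charInt_prod]
  congr 4
  rw [dotp_comb, dotp_comm v, dotp_comb, dotp_comm w (fun i => a * v i + b * w i), dotp_comb, dotp_comm w v]
  unfold IsUnitVec at hv hw
  rw [hv, hw, hc]
  linear_combination (-b^2) * hcs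

lemma map_single {d : ℕ} (v : Fin d → ℝ) (hv : IsUnitVec v) :
    (_root_.stdGaussian d).map (fun x => dotp v x) = gaussianReal 0 1 := by
  have h := map_pair v v 1 0 hv hv hv (by norm_num)
  have h2 := congrArg (fun m => m.map Prod.fst) h
  rw [Measure.map_map measurable_fst (by
    exact (measurable_dotp v).prodMk (measurable_dotp v)),
    Measure.map_map measurable_fst (by fun_prop)] at h2
  have e : (Prod.fst ∘ fun p : ℝ × ℝ => (p.1, 1 * p.1 + 0 * p.2)) = Prod.fst := rfl
  rw [e, Measure.map_fst_prod] at h2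
  simpa [Function.comp_def] using h2

lemma exists_polar : ∃ K : ℝ≥0∞, ∀ (D : Set (ℝ × ℝ)) (A : Set ℝ), MeasurableSet D →
    MeasurableSet A →
    (∀ r φ : ℝ, 0 < r → ((r * cos φ, r * sin φ) ∈ D ↔ φ ∈ A)) →
    ((gaussianReal 0 1).prod (gaussianReal 0 1)) D = K * volume (A ∩ Set.Ioo (-π) π) := by
  refine ⟨∫⁻ r in Set.Ioi (0:ℝ), ENNReal.ofReal r *
    ENNReal.ofReal ((√(2 * π))⁻¹ * (√(2 * π))⁻¹ * rexp (- r ^ 2 / 2)), ?_⟩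
  intro D A hD hA hDA
  rw [gaussianReal_of_var_ne_zero 0 one_ne_zero,
    prod_withDensity (measurable_gaussianPDF 0 1) (measurable_gaussianPDF 0 1),
    withDensity_apply _ hD, ← lintegral_indicator hD]
  rw [← Measure.volume_eq_prod, ← lintegral_comp_polarCoord_symm]
  rw [polarCoord_target, Measure.volume_eq_prod, ← Measure.prod_restrict]
  have e2 : volume (A ∩ Set.Ioo (-π) π) = ∫⁻ φ in Set.Ioo (-π) π, A.indicator 1 φ := by
    rw [lintegral_indicator_one hA, Measure.restrict_apply hA]
  rw [e2, ← lintegral_prod_mul (by fun_prop) ((measurable_one.indicator hA).aemeasurable),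
    Measure.prod_restrict]
  refine setLIntegral_congr_fun (measurableSet_Ioi.prod measurableSet_Ioo) ?_
  rintro ⟨r, φ⟩ ⟨hr, hφ⟩
  simp only [Set.mem_Ioi] at hr
  simp only [polarCoord_symm_apply, smul_eq_mul]
  by_cases hm : φ ∈ A
  · rw [Set.indicator_of_mem ((hDA r φ hr).2 hm), Set.indicator_of_mem hm]
    simp only [Pi.one_apply, mul_one, gaussianPDF]
    rw [← ENNReal.ofReal_mul (gaussianPDFReal_nonneg _ _ _)]
    congr 2
    simp only [gaussianPDFReal, NNReal.coe_one, mul_one, sub_zero]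
    rw [mul_mul_mul_comm, ← Real.exp_add]
    congr 2
    linear_combination (-r^2/2) * (Real.sin_sq_add_cos_sq φ)
  · rw [Set.indicator_of_notMem (fun h => hm ((hDA r φ hr).1 h)), Set.indicator_of_notMem hm]
    simp

lemma polar_real (D : Set (ℝ × ℝ)) (A : Set ℝ) (hD : MeasurableSet D) (hA : MeasurableSet A)
    (h : ∀ r φ : ℝ, 0 < r → ((r * cos φ, r * sin φ) ∈ D ↔ φ ∈ A)) :
    ((gaussianReal 0 1).prod (gaussianReal 0 1)).real D =
      volume.real (A ∩ Set.Ioo (-π) π) / (2 * π) := by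
  obtain ⟨K, hK⟩ := exists_polar
  have h1 := hK Set.univ Set.univ MeasurableSet.univ MeasurableSet.univ (by simp)
  have h2 := hK D A hD hA h
  have h1' := congrArg ENNReal.toReal h1
  rw [measure_univ, Set.univ_inter, Real.volume_Ioo, ENNReal.toReal_mul, ENNReal.toReal_ofReal (by linarith [pi_pos])] at h1'
  simp only [ENNReal.toReal_one] at h1'
  rw [Measure.real, h2, ENNReal.toReal_mul, Measure.real, eq_div_iff (by positivity)]
  linear_combination (-(volume (A ∩ Set.Ioo (-π) π)).toReal) * h1'

/-- disagreement set of angles -/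
def angSet (θ : ℝ) : Set ℝ := {φ | ¬ (0 ≤ cos φ ↔ 0 ≤ cos (φ - θ))}

lemma measurableSet_angSet (θ : ℝ) : MeasurableSet (angSet θ) := by
  have h1 : MeasurableSet {φ : ℝ | 0 ≤ cos φ} := measurableSet_le measurable_const (by fun_prop)
  have h2 : MeasurableSet {φ : ℝ | 0 ≤ cos (φ - θ)} :=
    measurableSet_le measurable_const (by fun_prop)
  have := (h1.iff h2).compl
  exact this

lemma volume_angSet (θ : ℝ) (h0 : 0 ≤ θ) (h1 : θ ≤ π) :
    volume.real (angSet θ ∩ Set.Ioo (-π) π) = 2 * θ := by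
  have hA := measurableSet_angSet θ
  have hpi := pi_pos
  set g : ℝ → ℝ := (angSet θ).indicator 1 with hg
  have hper : Function.Periodic g (2 * π) := by
    intro x
    have : x + 2 * π ∈ angSet θ ↔ x ∈ angSet θ := by
      simp only [angSet, Set.mem_ofPred_eq]
      rw [show x + 2 * π - θ = (x - θ) + 2 * π by ring, Real.cos_add_two_pi, Real.cos_add_two_pi]
    by_cases hx : x ∈ angSet θ
    · rw [hg, Set.indicator_of_mem hx, Set.indicator_of_mem (this.2 hx)]; rfl
    · rw [hg, Set.indicator_of_notMem hx, Set.indicator_of_notMem (fun h => hx (this.1 h))]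
  have hint : ∀ a b : ℝ, IntervalIntegrable g volume a b := by
    intro a b
    constructor <;>
    exact (integrable_const (1:ℝ)).indicator hA
  have hI : ∫ x in (-π)..(-π + 2 * π), g x = volume.real (angSet θ ∩ Set.Ioo (-π) π) := by
    rw [intervalIntegral.integral_of_le (by linarith), show -π + 2 * π = π by ring,
      integral_Ioc_eq_integral_Ioo, hg, integral_indicator_one hA,
      measureReal_restrict_apply hA]
  rw [← hI, hper.intervalIntegral_add_eq (-π) (-(π/2))]
  rw [← intervalIntegral.integral_add_adjacent_intervals (hint _ (θ - π/2)) (hint _ _),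
    ← intervalIntegral.integral_add_adjacent_intervals (hint (θ - π/2) (π/2)) (hint _ _),
    ← intervalIntegral.integral_add_adjacent_intervals (hint (π/2) (π/2+θ)) (hint _ _)]
  have i1 : ∫ x in (-(π/2))..(θ - π/2), g x = ∫ x in (-(π/2))..(θ - π/2), (1:ℝ) := by
    refine intervalIntegral.integral_congr_Ioo_of_le (by linarith) ?_
    rintro x ⟨hx1, hx2⟩
    refine Set.indicator_of_mem ?_ _
    have c1 : 0 < cos x := cos_pos_of_mem_Ioo ⟨by linarith, by linarith⟩
    have c2 : cos (x - θ) < 0 := by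
      rw [← cos_neg]; exact cos_neg_of_pi_div_two_lt_of_lt (by linarith) (by linarith)
    simp [angSet, c1.le, c2]
  have i2 : ∫ x in (θ - π/2)..(π/2), g x = ∫ x in (θ - π/2)..(π/2), (0:ℝ) := by
    refine intervalIntegral.integral_congr_Ioo_of_le (by linarith) ?_
    rintro x ⟨hx1, hx2⟩
    refine Set.indicator_of_notMem ?_ _
    have c1 : 0 < cos x := cos_pos_of_mem_Ioo ⟨by linarith, by linarith⟩
    have c2 : 0 < cos (x - θ) := cos_pos_of_mem_Ioo ⟨by linarith, by linarith⟩
    simp [angSet, c1.le, c2.le]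
  have i3 : ∫ x in (π/2)..(π/2+θ), g x = ∫ x in (π/2)..(π/2+θ), (1:ℝ) := by
    refine intervalIntegral.integral_congr_Ioo_of_le (by linarith) ?_
    rintro x ⟨hx1, hx2⟩
    refine Set.indicator_of_mem ?_ _
    have c1 : cos x < 0 := cos_neg_of_pi_div_two_lt_of_lt (by linarith) (by linarith)
    have c2 : 0 < cos (x - θ) := cos_pos_of_mem_Ioo ⟨by linarith, by linarith⟩
    simp [angSet, c1, c2.le]
  have i4 : ∫ x in (π/2+θ)..(-(π/2)+2*π), g x = ∫ x in (π/2+θ)..(-(π/2)+2*π), (0:ℝ) := by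
    refine intervalIntegral.integral_congr_Ioo_of_le (by linarith) ?_
    rintro x ⟨hx1, hx2⟩
    refine Set.indicator_of_notMem ?_ _
    have c1 : cos x < 0 := cos_neg_of_pi_div_two_lt_of_lt (by linarith) (by linarith)
    have c2 : cos (x - θ) < 0 := cos_neg_of_pi_div_two_lt_of_lt (by linarith) (by linarith)
    simp [angSet, not_le.2 c1, not_le.2 c2]
  rw [i1, i2, i3, i4]
  simp
  ring

/-- disagreement set -/
def disag {d : ℕ} (v w : Fin d → ℝ) : Set (Fin d → ℝ) := {x | sgn (dotp v x) ≠ sgn (dotp w x)}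

lemma sgn_ne_iff (a b : ℝ) : sgn a ≠ sgn b ↔ ¬ (0 ≤ a ↔ 0 ≤ b) := by
  unfold sgn
  split_ifs with h1 h2 h2 <;> simp [h1, h2] <;> norm_num

lemma measurableSet_pairD : MeasurableSet {p : ℝ × ℝ | ¬ (0 ≤ p.1 ↔ 0 ≤ p.2)} := by
  have h1 : MeasurableSet {p : ℝ × ℝ | 0 ≤ p.1} := measurableSet_le measurable_const (by fun_prop)
  have h2 : MeasurableSet {p : ℝ × ℝ | 0 ≤ p.2} := measurableSet_le measurable_const (by fun_prop)
  exact (h1.iff h2).compl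

lemma disag_eq {d : ℕ} (v w : Fin d → ℝ) : disag v w =
    (fun x => (dotp v x, dotp w x)) ⁻¹' {p : ℝ × ℝ | ¬ (0 ≤ p.1 ↔ 0 ≤ p.2)} := by
  ext x
  simp only [disag, Set.mem_ofPred_eq, sgn_ne_iff, Set.mem_preimage]

lemma measurableSet_disag {d : ℕ} (v w : Fin d → ℝ) : MeasurableSet (disag v w) := by
  rw [disag_eq]
  exact ((measurable_dotp v).prodMk (measurable_dotp w)) measurableSet_pairD

lemma dotp_sq_le {d : ℕ} (v w : Fin d → ℝ) (hv : IsUnitVec v) (hw : IsUnitVec w) :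
    (dotp v w) ^ 2 ≤ 1 := by
  have := Finset.sum_mul_sq_le_sq_mul_sq Finset.univ v w
  unfold IsUnitVec dotp at hv hw
  unfold dotp
  simp only [← pow_two] at hv hw
  rwa [hv, hw, one_mul] at this

lemma prob_disag {d : ℕ} (v w : Fin d → ℝ) (hv : IsUnitVec v) (hw : IsUnitVec w) :
    (_root_.stdGaussian d).real (disag v w) = angleOf v w / π := by
  have hsq := abs_le_one_iff_mul_self_le_one.2 (by
    have := dotp_sq_le v w hv hw; rwa [pow_two] at this)
  obtain ⟨hl, hu⟩ := abs_le.1 hsq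
  set θ := angleOf v w with hθ
  have hcos : dotp v w = cos θ := by rw [hθ, angleOf, cos_arccos hl hu]
  have hmp := map_pair v w (cos θ) (sin θ) hv hw hcos (by rw [add_comm]; exact sin_sq_add_cos_sq θ)
  rw [disag_eq, ← map_measureReal_apply ((measurable_dotp v).prodMk (measurable_dotp w))
    measurableSet_pairD, hmp, map_measureReal_apply (by fun_prop) measurableSet_pairD]
  rw [polar_real _ (angSet θ) (measurableSet_pairD.preimage (by fun_prop))
    (measurableSet_angSet θ), volume_angSet θ (arccos_nonneg _) (arccos_le_pi _)]
  · field_simp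
  · intro r φ hr
    simp only [Set.mem_preimage, Set.mem_ofPred_eq, angSet]
    rw [show cos θ * (r * cos φ) + sin θ * (r * sin φ) = r * cos (φ - θ) by rw [cos_sub]; ring,
      mul_nonneg_iff_of_pos_left hr, mul_nonneg_iff_of_pos_left hr]

/-- the set where `u` is too close to the boundary -/
def bad {d : ℕ} (M : ℕ) (u : Fin d → ℝ) : Set (Fin d → ℝ) :=
  {x | |dotp u x| ≤ (∑ i, |x i|) / M}

lemma measurableSet_bad {d : ℕ} (M : ℕ) (u : Fin d → ℝ) : MeasurableSet (bad M u) := by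
  have := measurable_dotp u
  exact measurableSet_le this.abs (by fun_prop)

lemma sgn_eq_of_notMem_bad {d : ℕ} {M : ℕ} {u v x : Fin d → ℝ}
    (huv : ∀ i, |v i - u i| ≤ 1 / M) (hx : x ∉ bad M u) : sgn (dotp v x) = sgn (dotp u x) := by
  have hx' : (∑ i, |x i|) / M < |dotp u x| := not_le.1 hx
  have h1 : |dotp v x - dotp u x| ≤ (∑ i, |x i|) / M := by
    unfold dotp
    rw [← Finset.sum_sub_distrib, Finset.sum_div]
    refine (Finset.abs_sum_le_sum_abs _ _).trans (Finset.sum_le_sum fun i _ => ?_)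
    rw [← sub_mul, abs_mul]
    calc |v i - u i| * |x i| ≤ 1 / M * |x i| :=
          mul_le_mul_of_nonneg_right (huv i) (abs_nonneg _)
      _ = |x i| / M := by ring
  have h2 := lt_of_le_of_lt h1 hx'
  unfold sgn
  rcases le_or_gt 0 (dotp u x) with h | h
  · rw [abs_of_nonneg h] at h2
    have := (abs_lt.1 h2).1
    rw [if_pos h, if_pos (by linarith)]
  · rw [abs_of_neg h] at h2
    have := (abs_lt.1 h2).2
    rw [if_neg (by linarith), if_neg (by linarith)]

lemma disag_subset {d : ℕ} {M : ℕ} {u v u' v' : Fin d → ℝ}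
    (h : ∀ i, |v i - u i| ≤ 1 / M) (h' : ∀ i, |v' i - u' i| ≤ 1 / M) (x : Fin d → ℝ) :
    (x ∈ disag v v' → x ∈ disag u u' ∨ x ∈ bad M u ∨ x ∈ bad M u') ∧
    (x ∈ disag u u' → x ∈ disag v v' ∨ x ∈ bad M u ∨ x ∈ bad M u') := by
  by_cases hx : x ∈ bad M u
  · simp [hx]
  by_cases hx' : x ∈ bad M u'
  · simp [hx']
  have e1 := sgn_eq_of_notMem_bad h hx
  have e2 := sgn_eq_of_notMem_bad h' hx'
  have e3 : x ∈ disag v v' ↔ x ∈ disag u u' := by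
    simp only [disag, Set.mem_ofPred_eq, e1, e2]
  exact ⟨fun h => Or.inl (e3.1 h), fun h => Or.inl (e3.2 h)⟩

lemma gaussian_small (t : ℝ) (ht : 0 ≤ t) : (gaussianReal 0 1).real (Set.Icc (-t) t) ≤ t := by
  rw [Measure.real, gaussianReal_apply_eq_integral _ one_ne_zero, ENNReal.toReal_ofReal
    (integral_nonneg fun x => gaussianPDFReal_nonneg _ _ _)]
  have h2 : ∀ x, gaussianPDFReal 0 1 x ≤ 1 / 2 := by
    intro x
    simp only [gaussianPDFReal, NNReal.coe_one, mul_one, sub_zero]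
    have a : (√(2 * π))⁻¹ ≤ 1 / 2 := by
      rw [one_div]
      apply inv_anti₀ (by norm_num)
      apply Real.le_sqrt_of_sq_le
      nlinarith [Real.pi_gt_three]
    have b : rexp (-x ^ 2 / 2) ≤ 1 := by
      rw [Real.exp_le_one_iff]
      nlinarith [sq_nonneg x]
    calc _ ≤ (√(2 * π))⁻¹ * 1 := by gcongr
      _ ≤ _ := by linarith
  calc ∫ x in Set.Icc (-t) t, gaussianPDFReal 0 1 x ≤ ∫ x in Set.Icc (-t) t, (1 / 2 : ℝ) := by
        refine setIntegral_mono (integrable_gaussianPDFReal 0 1).integrableOn ?_ h2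
        simp
    _ = t := by
        simp only [integral_const, smul_eq_mul, measureReal_restrict_apply_univ, Real.volume_real_Icc]
        rw [max_eq_left (by linarith)]
        ring

lemma integrable_sq_gaussian : Integrable (fun x : ℝ => x ^ 2) (gaussianReal 0 1) :=
  (memLp_id_gaussianReal (μ := 0) (v := 1) 2).integrable_sq

lemma integral_sq_gaussian : ∫ x : ℝ, x ^ 2 ∂(gaussianReal 0 1) = 1 := by
  have h := variance_id_gaussianReal (μ := 0) (v := 1)
  rw [variance_eq_integral (by fun_prop)] at h
  simpa using h

lemma integrable_abs_gaussian : Integrable (fun x : ℝ => |x|) (gaussianReal 0 1) :=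
  ((memLp_id_gaussianReal (μ := 0) (v := 1) 1).integrable le_rfl).abs

lemma integral_abs_gaussian : ∫ x : ℝ, |x| ∂(gaussianReal 0 1) ≤ 1 := by
  calc ∫ x : ℝ, |x| ∂(gaussianReal 0 1) ≤ ∫ x : ℝ, (1 / 2 + x ^ 2 / 2) ∂(gaussianReal 0 1) := by
        refine integral_mono integrable_abs_gaussian
          ((integrable_const _).add (integrable_sq_gaussian.div_const 2)) fun x => ?_
        have := sq_nonneg (|x| - 1)
        have h2 := sq_abs x
        simp only
        nlinarith
    _ = 1 := by
        rw [integral_add (integrable_const _) (integrable_sq_gaussian.div_const 2),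
          integral_div (2:ℝ) (fun x : ℝ => x ^ 2), integral_sq_gaussian]
        simp
        norm_num

lemma sum_abs_integral (d : ℕ) :
    Integrable (fun x : Fin d → ℝ => ∑ i, |x i|) (_root_.stdGaussian d) ∧
    ∫ x : Fin d → ℝ, ∑ i, |x i| ∂(_root_.stdGaussian d) ≤ d := by
  have hi : ∀ i : Fin d, Integrable (fun x : Fin d → ℝ => |x i|) (_root_.stdGaussian d) := by
    intro i
    exact (measurePreserving_eval (fun _ : Fin d => gaussianReal 0 1) i).integrable_comp_of_integrable
      integrable_abs_gaussian
  refine ⟨integrable_finsetSum _ fun i _ => hi i, ?_⟩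
  rw [integral_finsetSum _ fun i _ => hi i]
  calc ∑ i, ∫ x : Fin d → ℝ, |x i| ∂(_root_.stdGaussian d) ≤ ∑ i : Fin d, (1:ℝ) := by
        refine Finset.sum_le_sum fun i _ => ?_
        have := (measurePreserving_eval (fun _ : Fin d => gaussianReal 0 1) i).map_eq
        have h := integral_map (μ := _root_.stdGaussian d) (φ := fun x => x i)
          (f := fun y : ℝ => |y|) (measurable_pi_apply i).aemeasurable (by fun_prop)
        rw [← h]
        have e : Measure.map (fun x => x i) (_root_.stdGaussian d) = gaussianReal 0 1 := this
        rw [e]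
        exact integral_abs_gaussian
    _ = d := by simp

lemma prob_bad {d : ℕ} (M : ℕ) (hM : 0 < M) (u : Fin d → ℝ) (hu : IsUnitVec u) (ε : ℝ) (hε : 0 < ε)
    (hMd : 4 * d / ε ^ 2 ≤ M) : (_root_.stdGaussian d).real (bad M u) ≤ ε := by
  have hM' : (0:ℝ) < M := by exact_mod_cast hM
  have hsub : bad M u ⊆ (fun x => dotp u x) ⁻¹' (Set.Icc (-(ε/2)) (ε/2)) ∪
      {x | M * (ε / 2) ≤ ∑ i, |x i|} := by
    intro x hx
    by_cases h : M * (ε / 2) ≤ ∑ i, |x i|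
    · exact Or.inr h
    · left
      have h3 : (∑ i, |x i|) / M ≤ ε / 2 := by
        rw [div_le_iff₀ hM']; linarith [not_le.1 h]
      have hx' : |dotp u x| ≤ (∑ i, |x i|) / M := hx
      exact abs_le.1 (hx'.trans h3)
  refine (measureReal_mono hsub).trans ((measureReal_union_le _ _).trans ?_)
  have h1 : (_root_.stdGaussian d).real ((fun x => dotp u x) ⁻¹' (Set.Icc (-(ε/2)) (ε/2))) ≤ ε/2 := by
    rw [← map_measureReal_apply (measurable_dotp u) measurableSet_Icc, map_single u hu]
    exact gaussian_small _ (by linarith)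
  obtain ⟨hi, hle⟩ := sum_abs_integral d
  have h2 := mul_meas_ge_le_integral_of_nonneg (μ := _root_.stdGaussian d)
    (f := fun x : Fin d → ℝ => ∑ i, |x i|)
    (Filter.Eventually.of_forall fun x => Finset.sum_nonneg fun i _ => abs_nonneg _) hi (M * (ε/2))
  have h3 := h2.trans hle
  rw [div_le_iff₀ (by positivity)] at hMd
  set q := (_root_.stdGaussian d).real {x | M * (ε / 2) ≤ ∑ i, |x i|} with hq
  have h4 : q ≤ ε / 2 := by
    by_contra hcon
    push Not at hcon
    have : M * (ε / 2) * (ε / 2) < M * (ε / 2) * q := by gcongr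
    have h3' : M * (ε / 2) * q ≤ d := h3
    nlinarith
  linarith

lemma frac_eq {N : ℕ} {α : Type*} (S : Fin N → α) (A : Set α) :
    frac S (fun x => x ∈ A) = (∑ i, A.indicator (1 : α → ℝ) (S i)) / N := by
  classical
  unfold frac cnt
  congr 1
  rw [Nat.card_eq_fintype_card, Fintype.card_subtype, Finset.card_eq_sum_ones, Finset.sum_filter]
  push_cast
  refine Finset.sum_congr rfl fun i _ => ?_
  by_cases h : S i ∈ A <;> simp [h]

lemma frac_le_three {N : ℕ} {α : Type*} (S : Fin N → α) (A B C D : Set α)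
    (h : ∀ x, x ∈ A → x ∈ B ∨ x ∈ C ∨ x ∈ D) :
    frac S (fun x => x ∈ A) ≤ frac S (fun x => x ∈ B) + frac S (fun x => x ∈ C)
      + frac S (fun x => x ∈ D) := by
  classical
  rw [frac_eq, frac_eq, frac_eq, frac_eq, ← add_div, ← add_div, ← Finset.sum_add_distrib,
    ← Finset.sum_add_distrib]
  refine div_le_div_of_nonneg_right (Finset.sum_le_sum fun i _ => ?_) (Nat.cast_nonneg _)
  have := h (S i)
  simp only [Set.indicator_apply, Pi.one_apply]
  split_ifs <;> first | (exfalso; tauto) | norm_num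

lemma real_le_three {α : Type*} [MeasurableSpace α] (P : Measure α) [IsProbabilityMeasure P]
    (A B C D : Set α) (h : ∀ x, x ∈ A → x ∈ B ∨ x ∈ C ∨ x ∈ D) :
    P.real A ≤ P.real B + P.real C + P.real D := by
  have h1 : A ⊆ B ∪ (C ∪ D) := h
  have h2 := measureReal_mono (μ := P) h1
  have h3 := measureReal_union_le (μ := P) B (C ∪ D)
  have h4 := measureReal_union_le (μ := P) C D
  linarith

lemma measurable_frac {N : ℕ} {α : Type*} [MeasurableSpace α] (A : Set α) (hA : MeasurableSet A) :
    Measurable (fun S : Fin N → α => frac S (fun x => x ∈ A)) := by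
  simp_rw [frac_eq]
  have : Measurable (A.indicator (1 : α → ℝ)) := measurable_one.indicator hA
  fun_prop

lemma hoeffding_one {N : ℕ} (hN : 0 < N) {α : Type*} [MeasurableSpace α] (P : Measure α)
    [IsProbabilityMeasure P] (A : Set α) (hA : MeasurableSet A) (ε : ℝ) (hε : 0 < ε) :
    (Measure.pi fun _ : Fin N => P).real {S | ε ≤ frac S (fun x => x ∈ A) - P.real A} ≤
      rexp (-(2 * N * ε ^ 2)) := by
  have hN' : (0:ℝ) < N := by exact_mod_cast hN
  have hm : Measurable (A.indicator (1 : α → ℝ)) := measurable_one.indicator hA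
  have hind : iIndepFun (fun (i : Fin N) (S : Fin N → α) =>
      A.indicator (1 : α → ℝ) (S i) - P.real A) (Measure.pi fun _ : Fin N => P) :=
    iIndepFun_pi (X := fun _ x => A.indicator (1 : α → ℝ) x - P.real A)
      (fun i => (hm.sub_const _).aemeasurable)
  have hsub : ∀ i ∈ Finset.univ, HasSubgaussianMGF (fun (S : Fin N → α) =>
      A.indicator (1 : α → ℝ) (S i) - P.real A) ((‖(1:ℝ) - 0‖₊ / 2) ^ 2)
      (Measure.pi fun _ : Fin N => P) := by
    intro i _
    have h := hasSubgaussianMGF_of_mem_Icc (μ := Measure.pi fun _ : Fin N => P)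
      (X := fun S : Fin N → α => A.indicator (1 : α → ℝ) (S i)) (a := 0) (b := 1)
      (hm.comp (measurable_pi_apply i)).aemeasurable
      (Filter.Eventually.of_forall fun S => by
        by_cases hS : S i ∈ A <;> simp [hS])
    have e : ∫ S : Fin N → α, A.indicator (1 : α → ℝ) (S i) ∂(Measure.pi fun _ : Fin N => P)
        = P.real A := by
      have h1 := integral_map (μ := Measure.pi fun _ : Fin N => P)
        (φ := fun S : Fin N → α => S i) (f := A.indicator (1 : α → ℝ)) (measurable_pi_apply i).aemeasurable
        hm.aestronglyMeasurable
      have h2 : Measure.map (fun S : Fin N → α => S i) (Measure.pi fun _ : Fin N => P) = P :=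
        (measurePreserving_eval (fun _ : Fin N => P) i).map_eq
      rw [← h1, h2, integral_indicator_one hA]
    rw [e] at h
    exact h
  have h := HasSubgaussianMGF.measure_sum_ge_le_of_iIndepFun hind hsub (ε := N * ε) (by positivity)
  have e1 : {S : Fin N → α | N * ε ≤ ∑ i, (A.indicator (1 : α → ℝ) (S i) - P.real A)} =
      {S | ε ≤ frac S (fun x => x ∈ A) - P.real A} := by
    ext S
    simp only [Set.mem_ofPred_eq]
    rw [frac_eq, Finset.sum_sub_distrib, le_sub_iff_add_le, le_sub_iff_add_le, le_div_iff₀ hN']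
    simp only [Finset.sum_const, Finset.card_univ, Fintype.card_fin, nsmul_eq_mul]
    rw [add_mul, mul_comm ε, mul_comm (P.real A)]
  rw [e1] at h
  refine h.trans (le_of_eq ?_)
  congr 1
  simp
  field_simp

lemma hoeffding_two {N : ℕ} (hN : 0 < N) {α : Type*} [MeasurableSpace α] (P : Measure α)
    [IsProbabilityMeasure P] (A : Set α) (hA : MeasurableSet A) (ε : ℝ) (hε : 0 < ε) :
    (Measure.pi fun _ : Fin N => P).real {S | ε < |frac S (fun x => x ∈ A) - P.real A|} ≤
      2 * rexp (-(2 * N * ε ^ 2)) := by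
  have hN' : (0:ℝ) < N := by exact_mod_cast hN
  have h1 := hoeffding_one hN P A hA ε hε
  have h2 := hoeffding_one hN P Aᶜ hA.compl ε hε
  have hs : {S : Fin N → α | ε < |frac S (fun x => x ∈ A) - P.real A|} ⊆
      {S | ε ≤ frac S (fun x => x ∈ A) - P.real A} ∪
      {S | ε ≤ frac S (fun x => x ∈ Aᶜ) - P.real Aᶜ} := by
    intro S hS
    have hc : frac S (fun x => x ∈ Aᶜ) = 1 - frac S (fun x => x ∈ A) := by
      rw [frac_eq, frac_eq, eq_sub_iff_add_eq, ← add_div, ← Finset.sum_add_distrib,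
        div_eq_one_iff_eq hN'.ne']
      have : ∀ i, Aᶜ.indicator (1 : α → ℝ) (S i) + A.indicator (1 : α → ℝ) (S i) = 1 := by
        intro i
        by_cases h : S i ∈ A <;> simp [h]
      simp [this]
    have hp : P.real Aᶜ = 1 - P.real A := probReal_compl_eq_one_sub hA
    have hS' : ε < |frac S (fun x => x ∈ A) - P.real A| := hS
    rcases lt_abs.1 hS' with h | h
    · exact Or.inl h.le
    · right
      simp only [Set.mem_ofPred_eq]
      rw [hc, hp]
      linarith
  refine (measureReal_mono hs).trans ((measureReal_union_le _ _).trans ?_)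
  linarith

lemma exists_net (d M : ℕ) (hM : 0 < M) : ∃ G : Finset (Fin d → ℝ), (∀ u ∈ G, IsUnitVec u) ∧
    G.card ≤ (2 * M + 1) ^ d ∧
    ∀ v, IsUnitVec v → ∃ u ∈ G, ∀ i, |v i - u i| ≤ 1 / (M:ℝ) := by
  classical
  have hM' : (0:ℝ) < M := by exact_mod_cast hM
  let κ : (Fin d → ℝ) → (Fin d → ℤ) := fun v i => ⌊M * v i⌋
  let s : Set (Fin d → ℝ) := {v | IsUnitVec v}
  let cells : Finset (Fin d → ℤ) := Fintype.piFinset fun _ => Finset.Icc (-(M:ℤ)) M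
  refine ⟨(cells.image (Function.invFunOn κ s)).filter IsUnitVec, ?_, ?_, ?_⟩
  · intro u hu
    exact (Finset.mem_filter.1 hu).2
  · refine (Finset.card_filter_le _ _).trans (Finset.card_image_le.trans ?_)
    simp only [cells, Fintype.card_piFinset, Int.card_Icc, Finset.prod_const, Finset.card_univ,
      Fintype.card_fin]
    apply le_of_eq
    congr 1
    omega
  · intro v hv
    have hmem : κ v ∈ κ '' s := ⟨v, hv, rfl⟩
    have h1 : Function.invFunOn κ s (κ v) ∈ s := Function.invFunOn_mem hmem
    have h2 : κ (Function.invFunOn κ s (κ v)) = κ v := Function.invFunOn_eq hmem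
    refine ⟨Function.invFunOn κ s (κ v), Finset.mem_filter.2 ⟨Finset.mem_image.2 ⟨κ v, ?_, rfl⟩, h1⟩, ?_⟩
    · simp only [cells, Fintype.mem_piFinset, Finset.mem_Icc]
      intro i
      have hvi : |v i| ≤ 1 := by
        rw [abs_le_one_iff_mul_self_le_one]
        have : dotp v v = 1 := hv
        rw [← this]
        exact Finset.single_le_sum (f := fun i => v i * v i)
          (fun i _ => mul_self_nonneg _) (Finset.mem_univ i)
      obtain ⟨ha, hb⟩ := abs_le.1 hvi
      constructor
      · rw [Int.le_floor]
        push_cast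
        nlinarith
      · have : ((⌊M * v i⌋ : ℤ) : ℝ) ≤ ((M : ℤ) : ℝ) := by
          refine (Int.floor_le _).trans ?_
          push_cast
          nlinarith
        exact_mod_cast this
    · intro i
      have h3 := congrFun h2 i
      simp only [κ] at h3
      have h4 := (Int.abs_sub_lt_one_of_floor_eq_floor h3).le
      rw [← mul_sub, abs_mul, abs_of_pos hM', abs_sub_comm] at h4
      rw [le_div_iff₀ hM']
      linarith

/-- resolution of the net -/
def reso (d : ℕ) (ε : ℝ) : ℕ := ⌈4 * d / ε ^ 2⌉₊ + 1

/-- the net -/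
def net (d : ℕ) (ε : ℝ) : Finset (Fin d → ℝ) :=
  (exists_net d (reso d ε) (Nat.succ_pos _)).choose

/-- acceptance predicate -/
def Good (d N : ℕ) (S : Fin N → (Fin d → ℝ)) (ε : ℝ) : Prop :=
  (∀ u ∈ net d ε, |frac S (fun x => x ∈ bad (reso d ε) u)
    - (_root_.stdGaussian d).real (bad (reso d ε) u)| ≤ ε) ∧
  (∀ p ∈ net d ε ×ˢ net d ε, |frac S (fun x => x ∈ disag p.1 p.2)
    - (_root_.stdGaussian d).real (disag p.1 p.2)| ≤ ε)

lemma measurableSet_good (d N : ℕ) (ε : ℝ) :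
    MeasurableSet {S : Fin N → (Fin d → ℝ) | Good d N S ε} := by
  have e : {S : Fin N → (Fin d → ℝ) | Good d N S ε} =
    (⋂ u ∈ net d ε, {S | |frac S (fun x => x ∈ bad (reso d ε) u)
      - (_root_.stdGaussian d).real (bad (reso d ε) u)| ≤ ε}) ∩
    (⋂ p ∈ net d ε ×ˢ net d ε, {S | |frac S (fun x => x ∈ disag p.1 p.2)
      - (_root_.stdGaussian d).real (disag p.1 p.2)| ≤ ε}) := by
    ext S
    simp only [Good, Set.mem_ofPred_eq, Set.mem_inter_iff, Set.mem_iInter]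
  rw [e]
  refine MeasurableSet.inter (Finset.measurableSet_biInter _ fun u _ => ?_)
    (Finset.measurableSet_biInter _ fun p _ => ?_)
  · exact measurableSet_le ((measurable_frac _ (measurableSet_bad _ u)).sub_const _).abs
      measurable_const
  · exact measurableSet_le ((measurable_frac _ (measurableSet_disag p.1 p.2)).sub_const _).abs
      measurable_const

lemma good_sound {d N : ℕ} {S : Fin N → (Fin d → ℝ)} {ε : ℝ} (hε : 0 < ε) (h : Good d N S ε)
    (v v' : Fin d → ℝ) (hv : IsUnitVec v) (hv' : IsUnitVec v') :
    |frac S (fun x => sgn (dotp v x) ≠ sgn (dotp v' x)) - angleOf v v' / π| ≤ 7 * ε := by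
  obtain ⟨hunit, -, hnet⟩ := (exists_net d (reso d ε) (Nat.succ_pos _)).choose_spec
  obtain ⟨u, hu, huv⟩ := hnet v hv
  obtain ⟨u', hu', huv'⟩ := hnet v' hv'
  have hM : 4 * d / ε ^ 2 ≤ (reso d ε : ℝ) := by
    unfold reso; push_cast
    linarith [Nat.le_ceil (4 * d / ε ^ 2)]
  have hb := prob_bad (reso d ε) (Nat.succ_pos _) u (hunit u hu) ε hε hM
  have hb' := prob_bad (reso d ε) (Nat.succ_pos _) u' (hunit u' hu') ε hε hM
  have f1 := abs_le.1 (h.1 u hu)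
  have f2 := abs_le.1 (h.1 u' hu')
  have f3 := abs_le.1 (h.2 (u, u') (Finset.mem_product.2 ⟨hu, hu'⟩))
  have hs := disag_subset huv huv'
  have g1 := frac_le_three S _ _ _ _ (fun x => (hs x).1)
  have g2 := frac_le_three S _ _ _ _ (fun x => (hs x).2)
  have g3 := real_le_three (_root_.stdGaussian d) _ _ _ _ (fun x => (hs x).1)
  have g4 := real_le_three (_root_.stdGaussian d) _ _ _ _ (fun x => (hs x).2)
  rw [prob_disag v v' hv hv'] at g3 g4
  change |frac S (fun x => x ∈ disag v v') - angleOf v v' / π| ≤ 7 * ε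
  rw [abs_le]
  simp only at f3
  constructor <;> linarith [f1.1, f1.2, f2.1, f2.2, f3.1, f3.2]

lemma bad_event_bound (d N : ℕ) (hN : 0 < N) (ε : ℝ) (hε : 0 < ε) :
    (Measure.pi fun _ : Fin N => _root_.stdGaussian d).real {S | ¬ Good d N S ε} ≤
      4 * (((2 * reso d ε + 1 : ℕ) : ℝ) ^ d) ^ 2 * rexp (-(2 * N * ε ^ 2)) := by
  obtain ⟨-, hcard, -⟩ := (exists_net d (reso d ε) (Nat.succ_pos _)).choose_spec
  set G := net d ε with hG
  change G.card ≤ _ at hcard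
  set E := rexp (-(2 * N * ε ^ 2)) with hE
  have hE0 : 0 ≤ E := (Real.exp_pos _).le
  have hs : {S : Fin N → (Fin d → ℝ) | ¬ Good d N S ε} ⊆
    (⋃ u ∈ G, {S | ε < |frac S (fun x => x ∈ bad (reso d ε) u)
      - (_root_.stdGaussian d).real (bad (reso d ε) u)|}) ∪
    (⋃ p ∈ G ×ˢ G, {S | ε < |frac S (fun x => x ∈ disag p.1 p.2)
      - (_root_.stdGaussian d).real (disag p.1 p.2)|}) := by
    intro S hS
    by_contra hcon
    apply hS
    simp only [Set.mem_union, Set.mem_iUnion, Set.mem_ofPred_eq, not_or, not_exists, not_lt] at hcon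
    exact ⟨fun u hu => hcon.1 u hu, fun p hp => hcon.2 p hp⟩
  have b1 := measureReal_biUnion_finset_le (μ := Measure.pi fun _ : Fin N => _root_.stdGaussian d) G
    (fun u => {S | ε < |frac S (fun x => x ∈ bad (reso d ε) u)
      - (_root_.stdGaussian d).real (bad (reso d ε) u)|})
  have b2 := measureReal_biUnion_finset_le (μ := Measure.pi fun _ : Fin N => _root_.stdGaussian d)
    (G ×ˢ G) (fun p => {S | ε < |frac S (fun x => x ∈ disag p.1 p.2)
      - (_root_.stdGaussian d).real (disag p.1 p.2)|})
  have c1 := b1.trans (Finset.sum_le_card_nsmul _ _ (2 * E) fun u _ =>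
    hoeffding_two hN _ _ (measurableSet_bad _ u) ε hε)
  have c2 := b2.trans (Finset.sum_le_card_nsmul _ _ (2 * E) fun p _ =>
    hoeffding_two hN _ _ (measurableSet_disag p.1 p.2) ε hε)
  rw [nsmul_eq_mul] at c1 c2
  refine (measureReal_mono hs).trans ((measureReal_union_le _ _).trans ((add_le_add c1 c2).trans ?_))
  have hc : (G.card : ℝ) ≤ ((2 * reso d ε + 1 : ℕ) : ℝ) ^ d := by exact_mod_cast hcard
  set Q := ((2 * reso d ε + 1 : ℕ) : ℝ) ^ d with hQ
  have hQ1 : 1 ≤ Q := one_le_pow₀ (by push_cast; linarith [Nat.cast_nonneg (α := ℝ) (reso d ε)])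
  rw [Finset.card_product]
  push_cast
  have hG0 : (0:ℝ) ≤ G.card := Nat.cast_nonneg _
  have k1 : (G.card : ℝ) ≤ Q ^ 2 := by nlinarith
  have k2 : (G.card : ℝ) * G.card ≤ Q ^ 2 := by nlinarith
  nlinarith

lemma numeric (d N : ℕ) (hd : 1 ≤ d) (ε δ : ℝ) (hε : ε ∈ Set.Ioo (0:ℝ) 1) (hδ : δ ∈ Set.Ioo (0:ℝ) 1)
    (hN : (100 * (d:ℝ) / (ε * δ)) ^ (100:ℝ) ≤ (N : ℝ)) :
    0 < N ∧ 4 * (((2 * reso d ε + 1 : ℕ) : ℝ) ^ d) ^ 2 * rexp (-(2 * N * ε ^ 2)) ≤ δ := by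
  obtain ⟨he0, he1⟩ := hε
  obtain ⟨hd0, hd1⟩ := hδ
  have hdr : (1:ℝ) ≤ d := by exact_mod_cast hd
  set y := 100 * (d:ℝ) / (ε * δ) with hy
  have hprod : ε * δ ≤ 1 := by nlinarith
  have hprod0 : 0 < ε * δ := by positivity
  have hy1 : 100 ≤ y := by
    rw [hy, le_div_iff₀ hprod0]; nlinarith
  have hN4 : y ^ 4 ≤ (N : ℝ) := by
    refine le_trans ?_ hN
    rw [show (100:ℝ) = ((100:ℕ) : ℝ) by norm_num, Real.rpow_natCast]
    exact pow_le_pow_right₀ (by linarith) (by norm_num)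
  have hNpos : (0:ℝ) < N := lt_of_lt_of_le (by positivity) hN4
  refine ⟨by exact_mod_cast hNpos, ?_⟩
  -- z = d / (ε δ)
  have hM : (reso d ε : ℝ) ≤ 6 * d / ε ^ 2 := by
    unfold reso
    push_cast
    have h1 := (Nat.ceil_lt_add_one (show 0 ≤ 4 * (d:ℝ) / ε ^ 2 by positivity)).le
    have h2 : (1:ℝ) ≤ d / ε ^ 2 := by
      rw [le_div_iff₀ (by positivity)]; nlinarith
    have h3 : 6 * (d:ℝ) / ε ^ 2 = 4 * d / ε ^ 2 + 2 * (d / ε ^ 2) := by ring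
    linarith
  have hQ : (((2 * reso d ε + 1 : ℕ) : ℝ) ^ d) ^ 2 ≤ rexp (4 * d * reso d ε) := by
    have : ((2 * reso d ε + 1 : ℕ) : ℝ) ≤ rexp (2 * reso d ε) := by
      push_cast; exact Real.add_one_le_exp _
    calc (((2 * reso d ε + 1 : ℕ) : ℝ) ^ d) ^ 2 ≤ ((rexp (2 * reso d ε)) ^ d) ^ 2 := by gcongr
      _ = _ := by
        rw [← Real.exp_nat_mul, ← Real.exp_nat_mul]
        congr 1
        push_cast
        ring
  have h4 : (4:ℝ) ≤ rexp 3 := by linarith [Real.add_one_le_exp (3:ℝ)]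
  have hδ' : rexp (-(1/δ)) ≤ δ := by
    rw [Real.exp_neg, inv_le_comm₀ (Real.exp_pos _) hd0]
    have := Real.add_one_le_exp (1/δ)
    rw [one_div] at this ⊢
    linarith
  have key : 3 + 4 * d * (reso d ε : ℝ) + 1 / δ ≤ 2 * N * ε ^ 2 := by
    set z := (d:ℝ) / (ε * δ) with hz
    have hz1 : 1 ≤ z := by rw [hz, le_div_iff₀ hprod0]; nlinarith
    have hyz : y = 100 * z := by rw [hy, hz]; ring
    have t1 : 4 * d * (reso d ε : ℝ) ≤ 24 * z ^ 2 := by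
      calc 4 * d * (reso d ε : ℝ) ≤ 4 * d * (6 * d / ε ^ 2) := by gcongr
        _ = 24 * (d / ε) ^ 2 := by field_simp; ring
        _ ≤ 24 * z ^ 2 := by
          have : d / ε ≤ z := by
            rw [hz]
            apply div_le_div_of_nonneg_left (by linarith) hprod0
            nlinarith
          gcongr
    have t2 : 1 / δ ≤ z ^ 2 := by
      have : 1 / δ ≤ z := by
        rw [hz, div_le_div_iff₀ hd0 hprod0]
        nlinarith
      nlinarith
    have t3 : 1 ≤ z * ε := by
      have : z * ε = d / δ := by rw [hz]; field_simp
      rw [this, le_div_iff₀ hd0]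
      linarith
    have t4 : 10 ^ 8 * z ^ 2 ≤ N * ε ^ 2 := by
      calc 10 ^ 8 * z ^ 2 ≤ 10 ^ 8 * z ^ 2 * (z * ε) ^ 2 := by
            have : 1 ≤ (z * ε) ^ 2 := one_le_pow₀ t3
            have hz2 : 0 ≤ 10 ^ 8 * z ^ 2 := by positivity
            exact le_mul_of_one_le_right hz2 this
        _ = y ^ 4 * ε ^ 2 := by rw [hyz]; ring
        _ ≤ N * ε ^ 2 := by gcongr
    nlinarith
  calc 4 * (((2 * reso d ε + 1 : ℕ) : ℝ) ^ d) ^ 2 * rexp (-(2 * N * ε ^ 2))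
      ≤ rexp 3 * rexp (4 * d * reso d ε) * rexp (-(2 * N * ε ^ 2)) := by gcongr
    _ = rexp (3 + 4 * d * reso d ε - 2 * N * ε ^ 2) := by
        rw [← Real.exp_add, ← Real.exp_add]; congr 1
    _ ≤ rexp (-(1/δ)) := by apply Real.exp_le_exp.2; linarith
    _ ≤ δ := hδ'

/-- The disagreement tester: for every `μ ∈ (0,1)` there are `C ≥ 1` and a tester `T`
(with measurable acceptance event) that is complete (accepts simultaneously for all unit
vectors `v`, with probability `≥ 1 - C·δ` over `N ≥ (C·d/(ε·δ))^C` i.i.d. standard Gaussian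
samples) and sound (acceptance certifies that all empirical disagreement probabilities equal
`(1 ± μ)·∠(v,v')/π ± C·ε`). -/
theorem disagreement_tester (μ : ℝ) (hμ : μ ∈ Set.Ioo (0:ℝ) 1) :
    ∃ (C : ℝ)
      (T : (d : ℕ) → (N : ℕ) → (Fin N → (Fin d → ℝ)) → (Fin d → ℝ) → ℝ → ℝ → Bool),
      1 ≤ C ∧
      ∀ d : ℕ, 1 ≤ d → ∀ (ε δ : ℝ), ε ∈ Set.Ioo (0:ℝ) 1 → δ ∈ Set.Ioo (0:ℝ) 1 →
        -- the acceptance event is measurable in the sample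
        (∀ (N : ℕ) (v : Fin d → ℝ),
          MeasurableSet {S : Fin N → (Fin d → ℝ) | T d N S v ε δ = true}) ∧
        -- completeness
        (∀ N : ℕ, (C * (d:ℝ) / (ε * δ)) ^ C ≤ (N : ℝ) →
          ENNReal.ofReal (1 - C * δ) ≤
            (Measure.pi fun _ : Fin N => stdGaussian d)
              {S | ∀ v : Fin d → ℝ, IsUnitVec v → T d N S v ε δ = true}) ∧
        -- soundness
        (∀ (N : ℕ) (S : Fin N → (Fin d → ℝ)) (v : Fin d → ℝ), IsUnitVec v →
          T d N S v ε δ = true →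
          ∀ v' : Fin d → ℝ, IsUnitVec v' →
            (1 - μ) * angleOf v v' / π - C * ε ≤
              frac S (fun x => sgn (dotp v x) ≠ sgn (dotp v' x)) ∧
            frac S (fun x => sgn (dotp v x) ≠ sgn (dotp v' x)) ≤
              (1 + μ) * angleOf v v' / π + C * ε) := by
  classical
  refine ⟨100, fun d N S _ ε _ => decide (Good d N S ε), by norm_num, ?_⟩
  intro d hd ε δ hε hδ
  refine ⟨?_, ?_, ?_⟩
  · intro N v
    simp only [decide_eq_true_eq]
    exact measurableSet_good d N ε
  · intro N hN
    obtain ⟨hN0, hnum⟩ := numeric d N hd ε δ hε hδ hN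
    have hb := (bad_event_bound d N hN0 ε hε.1).trans hnum
    have hc : (Measure.pi fun _ : Fin N => _root_.stdGaussian d).real {S | ¬ Good d N S ε} =
        1 - (Measure.pi fun _ : Fin N => _root_.stdGaussian d).real {S | Good d N S ε} :=
      probReal_compl_eq_one_sub (measurableSet_good d N ε)
    simp only [decide_eq_true_eq]
    refine (ENNReal.ofReal_le_ofReal (q := (Measure.pi fun _ : Fin N => _root_.stdGaussian d).real
      {S | Good d N S ε}) ?_).trans ?_
    · linarith [hδ.1]
    · rw [ofReal_measureReal]
      exact measure_mono fun S hS v _ => hS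
  · intro N S v hv hT v' hv'
    have hg : Good d N S ε := by simpa using hT
    obtain ⟨h1, h2⟩ := abs_le.1 (good_sound hε.1 hg v v' hv hv')
    have ha : 0 ≤ angleOf v v' / π := div_nonneg (arccos_nonneg _) pi_pos.le
    have hm := mul_nonneg hμ.1.le ha
    have e1 : (1 - μ) * angleOf v v' / π = angleOf v v' / π - μ * (angleOf v v' / π) := by ring
    have e2 : (1 + μ) * angleOf v v' / π = angleOf v v' / π + μ * (angleOf v v' / π) := by ring
    rw [e1, e2]
    have := hε.1
    constructor <;> linarith

end
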